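/- For every finite set V ⊆ [0,1] with {0,1} ⊆ V and every BQCTL*[F] state formula φ over AP, the set V(φ) = {⟦φ⟧_t(u) : t an (AP,V)-labelled D-tree, u a node of t} of satisfaction values taken by φ at nodes of (AP,V)-labelled D-trees has cardinality at most |V|^{|φ|}. -/

import Mathlib

open scoped Classical

mutual
inductive StateF (AP : Type) : Type where
  | atom : AP → StateF AP
  | app : (n : ℕ) → ((Fin n → ℝ) → ℝ) → (Fin n → StateF AP) → StateF AP
  | ex : AP → StateF AP → StateF AP
  | E : PathF AP → StateF AP

inductive PathF (AP : Type) : Type where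
  | state : StateF AP → PathF AP
  | next : PathF AP → PathF AP
  | until_ : PathF AP → PathF AP → PathF AP
  | app : (n : ℕ) → ((Fin n → ℝ) → ℝ) → (Fin n → PathF AP) → PathF AP
end

variable {AP D : Type}

mutual
def ssize : StateF AP → ℕ
  | .atom _ => 1
  | .app n _ args => 1 + Finset.univ.sum (fun i : Fin n => ssize (args i))
  | .ex _ φ => 1 + ssize φ
  | .E ψ => 1 + psize ψ
def psize : PathF AP → ℕ
  | .state φ => ssize φ
  | .next ψ => 1 + psize ψ
  | .until_ ψ₁ ψ₂ => 1 + psize ψ₁ + psize ψ₂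
  | .app n _ args => 1 + Finset.univ.sum (fun i : Fin n => psize (args i))
end

structure LTree (D L : Type) where
  dom : Set (List D)
  label : List D → L

def IsTree (t : LTree D L) : Prop :=
  ([] ∈ t.dom) ∧ (∀ u ∈ t.dom, ∀ v : List D, v <+: u → v ∈ t.dom) ∧
    (∀ u ∈ t.dom, ∃ d : D, u ++ [d] ∈ t.dom)

def Labelled (t : LTree D (AP → ℝ)) (V : Set ℝ) : Prop :=
  ∀ u ∈ t.dom, ∀ p, t.label u p ∈ V

def IsBranch (t : LTree D L) (u : List D) (lam : ℕ → List D) : Prop :=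
  lam 0 = u ∧ ∀ i, lam i ∈ t.dom ∧ ∃ d : D, lam (i + 1) = lam i ++ [d]

def PropEquiv (p : AP) (t t' : LTree D (AP → ℝ)) : Prop :=
  t'.dom = t.dom ∧
    ∀ u ∈ t.dom, (∀ q, q ≠ p → t'.label u q = t.label u q) ∧
      (t'.label u p = 0 ∨ t'.label u p = 1)

mutual
noncomputable def ssem : StateF AP → LTree D (AP → ℝ) → List D → ℝ
  | .atom p, t, u => t.label u p
  | .app n f args, t, u => f fun i => ssem (args i) t u
  | .ex p φ, t, u => sSup {v | ∃ t', PropEquiv p t t' ∧ ssem φ t' u = v}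
  | .E ψ, t, u => sSup {v | ∃ lam, IsBranch t u lam ∧ psem ψ t lam = v}
noncomputable def psem : PathF AP → LTree D (AP → ℝ) → (ℕ → List D) → ℝ
  | .state φ, t, lam => ssem φ t (lam 0)
  | .next ψ, t, lam => psem ψ t fun k => lam (1 + k)
  | .until_ ψ₁ ψ₂, t, lam =>
      sSup {v | ∃ i : ℕ,
        v = min (psem ψ₂ t fun k => lam (i + k))
          (sInf ({w | ∃ j < i, psem ψ₁ t (fun k => lam (j + k)) = w} ∪ {1}))}
  | .app n f args, t, lam => f fun i => psem (args i) t lam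
end

def ValS (D : Type) (V : Set ℝ) (φ : StateF AP) : Set ℝ :=
  {v | ∃ t : LTree D (AP → ℝ), ∃ u : List D,
    IsTree t ∧ Labelled t V ∧ u ∈ t.dom ∧ ssem φ t u = v}

def ValP (D : Type) (V : Set ℝ) (ψ : PathF AP) : Set ℝ :=
  {v | ∃ t : LTree D (AP → ℝ), ∃ u : List D, ∃ lam : ℕ → List D,
    IsTree t ∧ Labelled t V ∧ u ∈ t.dom ∧ IsBranch t u lam ∧ psem ψ t lam = v}

theorem ssize_pos (φ : StateF AP) : 1 ≤ ssize φ := by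
  cases φ <;> simp [ssize]

theorem psize_pos : ∀ ψ : PathF AP, 1 ≤ psize ψ
  | .state φ => by simpa only [psize] using ssize_pos φ
  | .next _ => by simp [psize]
  | .until_ ψ₁ ψ₂ => by simp only [psize]; omega
  | .app _ _ _ => by simp [psize]

theorem IsBranch.shift {L : Type} {t : LTree D L} {u : List D} {lam : ℕ → List D}
    (h : IsBranch t u lam) (i : ℕ) : IsBranch t (lam i) fun k => lam (i + k) :=
  ⟨rfl, fun k => h.2 (i + k)⟩

theorem IsTree.exists_isBranch {L : Type} {t : LTree D L} (ht : IsTree t) {u : List D}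
    (hu : u ∈ t.dom) : ∃ lam, IsBranch t u lam := by
  obtain ⟨d₀, _⟩ := ht.2.2 u hu
  have : Nonempty D := ⟨d₀⟩
  choose! d hd using ht.2.2
  have hmem : ∀ i, (fun v => v ++ [d v])^[i] u ∈ t.dom := by
    intro i
    induction i with
    | zero => exact hu
    | succ i ih => rw [Function.iterate_succ_apply']; exact hd _ ih
  exact ⟨fun i => (fun v => v ++ [d v])^[i] u, rfl,
    fun i => ⟨hmem i, _, Function.iterate_succ_apply' _ _ _⟩⟩

theorem exists_propEquiv (p : AP) (t : LTree D (AP → ℝ)) : ∃ t', PropEquiv p t t' :=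
  ⟨⟨t.dom, fun u => Function.update (t.label u) p 0⟩, rfl, fun u _ =>
    ⟨fun q hq => by simp [hq], by simp⟩⟩

theorem PropEquiv.isTree {p : AP} {t t' : LTree D (AP → ℝ)} (h : PropEquiv p t t')
    (ht : IsTree t) : IsTree t' := by
  unfold IsTree
  rw [h.1]
  exact ht

theorem PropEquiv.labelled {p : AP} {t t' : LTree D (AP → ℝ)} {V : Set ℝ}
    (h : PropEquiv p t t') (h0 : (0 : ℝ) ∈ V) (h1 : (1 : ℝ) ∈ V) (ht : Labelled t V) :
    Labelled t' V := by
  intro u hu q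
  rw [h.1] at hu
  by_cases hq : q = p
  · subst hq
    rcases (h.2 u hu).2 with h | h <;> rw [h] <;> assumption
  · rw [(h.2 u hu).1 q hq]
    exact ht u hu q

theorem Finset.csSup_mem_of_subset {s : Finset ℝ} {S : Set ℝ} (hS : S.Nonempty) (h : S ⊆ s) :
    sSup S ∈ s :=
  h (hS.csSup_mem (s.finite_toSet.subset h))

theorem Finset.csInf_mem_of_subset {s : Finset ℝ} {S : Set ℝ} (hS : S.Nonempty) (h : S ⊆ s) :
    sInf S ∈ s :=
  h (hS.csInf_mem (s.finite_toSet.subset h))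

theorem card_image_piFinset_le {n k : ℕ} (hk : 1 ≤ k) (f : (Fin n → ℝ) → ℝ)
    (s : Fin n → Finset ℝ) (a : Fin n → ℕ) (h : ∀ i, (s i).card ≤ k ^ a i) :
    ((Fintype.piFinset s).image f).card ≤ k ^ (1 + ∑ i, a i) :=
  calc ((Fintype.piFinset s).image f).card ≤ (Fintype.piFinset s).card := Finset.card_image_le
    _ = ∏ i, (s i).card := Fintype.card_piFinset s
    _ ≤ ∏ i, k ^ a i := Finset.prod_le_prod' fun i _ => h i
    _ = k ^ ∑ i, a i := Finset.prod_pow_eq_pow_sum _ _ _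
    _ ≤ k ^ (1 + ∑ i, a i) := Nat.pow_le_pow_right hk (Nat.le_add_left _ _)

theorem card_insert_union_le {k a b : ℕ} (hk : 2 ≤ k) (ha : 1 ≤ a) (hb : 1 ≤ b) (x : ℝ)
    {s₁ s₂ : Finset ℝ} (h₁ : s₁.card ≤ k ^ a) (h₂ : s₂.card ≤ k ^ b) :
    (insert x (s₁ ∪ s₂)).card ≤ k ^ (1 + a + b) := by
  have hc : (insert x (s₁ ∪ s₂)).card ≤ k ^ a + k ^ b + 1 :=
    (Finset.card_insert_le _ _).trans
      (Nat.succ_le_succ ((Finset.card_union_le _ _).trans (add_le_add h₁ h₂)))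
  have hka : 2 ≤ k ^ a := hk.trans (Nat.le_self_pow (by omega) k)
  have hkb : 2 ≤ k ^ b := hk.trans (Nat.le_self_pow (by omega) k)
  have hmul : 2 * (k ^ a * k ^ b) ≤ k ^ (1 + a + b) := by
    rw [pow_add, pow_add, pow_one, mul_assoc]
    exact Nat.mul_le_mul_right _ hk
  nlinarith [mul_le_mul hka hkb (Nat.zero_le _) (Nat.zero_le _)]

mutual
/-- The values of a state formula lie in a finite set of size at most `|V| ^ |φ|`. -/
theorem exists_finset_valS (s : Finset ℝ) (h0 : (0 : ℝ) ∈ s) (h1 : (1 : ℝ) ∈ s)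
    (hs : 2 ≤ s.card) : ∀ φ : StateF AP,
    ∃ r : Finset ℝ, ValS D (s : Set ℝ) φ ⊆ r ∧ r.card ≤ s.card ^ ssize φ
  | .atom p => by
      refine ⟨s, ?_, by simp [ssize]⟩
      rintro v ⟨t, u, _, hl, hu, rfl⟩
      simpa only [ssem] using hl u hu p
  | .app n f args => by
      choose r hr hc using fun i => exists_finset_valS s h0 h1 hs (args i)
      refine ⟨(Fintype.piFinset r).image f, ?_, ?_⟩
      · rintro v ⟨t, u, ht, hl, hu, rfl⟩
        simp only [ssem]
        exact Finset.mem_image_of_mem f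
          (Fintype.mem_piFinset.2 fun i => hr i ⟨t, u, ht, hl, hu, rfl⟩)
      · simpa only [ssize] using card_image_piFinset_le (by omega) f r _ hc
  | .ex p φ => by
      obtain ⟨r, hr, hc⟩ := exists_finset_valS s h0 h1 hs φ
      refine ⟨r, ?_, hc.trans (Nat.pow_le_pow_right (by omega) (by simp [ssize]))⟩
      rintro v ⟨t, u, ht, hl, hu, rfl⟩
      simp only [ssem]
      obtain ⟨t', ht'⟩ := exists_propEquiv p t
      refine Finset.csSup_mem_of_subset ⟨_, t', ht', rfl⟩ ?_
      rintro v ⟨t', h, rfl⟩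
      exact hr ⟨t', u, h.isTree ht, h.labelled h0 h1 hl, h.1 ▸ hu, rfl⟩
  | .E ψ => by
      obtain ⟨r, hr, hc⟩ := exists_finset_valP s h0 h1 hs ψ
      refine ⟨r, ?_, hc.trans (Nat.pow_le_pow_right (by omega) (by simp [ssize]))⟩
      rintro v ⟨t, u, ht, hl, hu, rfl⟩
      simp only [ssem]
      obtain ⟨lam, hlam⟩ := ht.exists_isBranch hu
      refine Finset.csSup_mem_of_subset ⟨_, lam, hlam, rfl⟩ ?_
      rintro v ⟨lam, h, rfl⟩
      exact hr ⟨t, u, lam, ht, hl, hu, h, rfl⟩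

/-- The values of a path formula lie in a finite set of size at most `|V| ^ |ψ|`. -/
theorem exists_finset_valP (s : Finset ℝ) (h0 : (0 : ℝ) ∈ s) (h1 : (1 : ℝ) ∈ s)
    (hs : 2 ≤ s.card) : ∀ ψ : PathF AP,
    ∃ r : Finset ℝ, ValP D (s : Set ℝ) ψ ⊆ r ∧ r.card ≤ s.card ^ psize ψ
  | .state φ => by
      obtain ⟨r, hr, hc⟩ := exists_finset_valS s h0 h1 hs φ
      refine ⟨r, ?_, by simpa only [psize] using hc⟩
      rintro v ⟨t, u, lam, ht, hl, _, hlam, rfl⟩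
      simp only [psem]
      exact hr ⟨t, lam 0, ht, hl, (hlam.2 0).1, rfl⟩
  | .next ψ => by
      obtain ⟨r, hr, hc⟩ := exists_finset_valP s h0 h1 hs ψ
      refine ⟨r, ?_, hc.trans (Nat.pow_le_pow_right (by omega) (by simp [psize]))⟩
      rintro v ⟨t, u, lam, ht, hl, _, hlam, rfl⟩
      simp only [psem]
      exact hr ⟨t, lam 1, _, ht, hl, (hlam.2 1).1, hlam.shift 1, rfl⟩
  | .until_ ψ₁ ψ₂ => by
      obtain ⟨r₁, hr₁, hc₁⟩ := exists_finset_valP s h0 h1 hs ψ₁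
      obtain ⟨r₂, hr₂, hc₂⟩ := exists_finset_valP s h0 h1 hs ψ₂
      refine ⟨insert 1 (r₁ ∪ r₂), ?_, ?_⟩
      · rintro v ⟨t, u, lam, ht, hl, _, hlam, rfl⟩
        simp only [psem]
        refine Finset.csSup_mem_of_subset ⟨_, 0, rfl⟩ ?_
        rintro v ⟨i, rfl⟩
        rcases min_choice (psem ψ₂ t fun k => lam (i + k))
          (sInf ({w | ∃ j < i, psem ψ₁ t (fun k => lam (j + k)) = w} ∪ {1})) with h | h <;> rw [h]
        · exact Finset.mem_insert_of_mem (Finset.mem_union_right _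
            (hr₂ ⟨t, lam i, _, ht, hl, (hlam.2 i).1, hlam.shift i, rfl⟩))
        · refine Finset.csInf_mem_of_subset ⟨1, Or.inr rfl⟩ ?_
          rintro w (⟨j, _, rfl⟩ | rfl)
          · exact Finset.mem_insert_of_mem (Finset.mem_union_left _
              (hr₁ ⟨t, lam j, _, ht, hl, (hlam.2 j).1, hlam.shift j, rfl⟩))
          · exact Finset.mem_insert_self _ _
      · simpa only [psize] using
          card_insert_union_le hs (psize_pos ψ₁) (psize_pos ψ₂) 1 hc₁ hc₂
  | .app n f args => by
      choose r hr hc using fun i => exists_finset_valP s h0 h1 hs (args i)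
      refine ⟨(Fintype.piFinset r).image f, ?_, ?_⟩
      · rintro v ⟨t, u, lam, ht, hl, hu, hlam, rfl⟩
        simp only [psem]
        exact Finset.mem_image_of_mem f
          (Fintype.mem_piFinset.2 fun i => hr i ⟨t, u, lam, ht, hl, hu, hlam, rfl⟩)
      · simpa only [psize] using card_image_piFinset_le (by omega) f r _ hc
end

/-- For every finite set `V ⊆ [0,1]` with `{0,1} ⊆ V` and every
BQCTL*[F] state formula `φ` over `AP`, the set of satisfaction values taken by `φ`
at nodes of `(AP,V)`-labelled `D`-trees is finite, of cardinality at most `|V| ^ |φ|`. -/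
theorem stmt0 {AP D : Type} [Fintype AP] [Fintype D] [Nonempty D]
    (V : Set ℝ) (hVfin : V.Finite) (hVsub : V ⊆ Set.Icc (0 : ℝ) 1)
    (h0 : (0 : ℝ) ∈ V) (h1 : (1 : ℝ) ∈ V) (φ : StateF AP) :
    (ValS D V φ).Finite ∧ (ValS D V φ).ncard ≤ V.ncard ^ ssize φ := by
  lift V to Finset ℝ using hVfin
  have hV : 2 ≤ V.card := Finset.one_lt_card.2 ⟨0, h0, 1, h1, zero_ne_one⟩
  obtain ⟨r, hr, hc⟩ := exists_finset_valS (D := D) V h0 h1 hV φ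
  refine ⟨r.finite_toSet.subset hr, ?_⟩
  rw [Set.ncard_coe_finset]
  exact ((Set.ncard_le_ncard hr r.finite_toSet).trans (Set.ncard_coe_finset r).le).trans hc
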